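/- Let γ(z; t) = (i/π)(1/(z − t) + t/(t² + 1)) be the modified Cauchy kernel. For every fixed y < 0 the map t ↦ γ(iy; t) is integrable on ℝ, and its Fourier transform satisfies: for x ≠ 0, ∫ℝ γ(iy; t) e^{ixt} dt = −2·𝟙_{(−∞,0]}(x)·e^{−yx} − sign(x)·e^{−|x|}, and for x = 0 the integral equals −1. -/

import Mathlib

open MeasureTheory Complex Set

noncomputable def modCauchyKernel (z : ℂ) (t : ℝ) : ℂ :=
  (Complex.I / (Real.pi : ℂ)) * (1 / (z - (t : ℂ)) + (t : ℂ) / ((t : ℂ) ^ 2 + 1))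

/-- The continuous function whose Fourier transform is the kernel. -/
noncomputable def auxG (y : ℝ) (x : ℝ) : ℂ :=
  if x ≤ 0 then -2 * cexp ((-y : ℂ) * x) + cexp ((1 : ℂ) * x) else -cexp ((-1 : ℂ) * x)

lemma auxG_continuous (y : ℝ) : Continuous (auxG y) := by
  unfold auxG
  refine Continuous.if_le (by fun_prop) (by fun_prop) continuous_id continuous_const ?_
  rintro x hx
  have : x = 0 := hx
  subst this
  simp
  norm_num

lemma aux_int (y : ℝ) (hy : y < 0) (t : ℝ) :
    Integrable (fun v : ℝ => cexp (-(I * t) * v) * auxG y v) ∧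
    ∫ v : ℝ, cexp (-(I * t) * v) * auxG y v =
      -2 * (1 / (-y - I * t)) + 1 / (1 - I * t) + 1 / (-1 - I * t) := by
  have r1 : 0 < (-y - I * t : ℂ).re := by simpa using hy
  have r2 : 0 < (1 - I * t : ℂ).re := by simp
  have r3 : (-1 - I * t : ℂ).re < 0 := by simp
  have i1 := integrableOn_exp_mul_complex_Iic r1 0
  have i2 := integrableOn_exp_mul_complex_Iic r2 0
  have i3 := integrableOn_exp_mul_complex_Ioi r3 0
  have e1 : EqOn (fun v : ℝ => cexp (-(I * t) * v) * auxG y v)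
      (fun v : ℝ => -2 * cexp ((-y - I * t) * v) + cexp ((1 - I * t) * v)) (Iic 0) := by
    intro v hv
    have hv' : v ≤ 0 := hv
    simp only [auxG, if_pos hv', sub_eq_add_neg, add_mul, Complex.exp_add]
    ring
  have e2 : EqOn (fun v : ℝ => cexp (-(I * t) * v) * auxG y v)
      (fun v : ℝ => - cexp ((-1 - I * t) * v)) (Ioi 0) := by
    intro v hv
    have hv' : ¬ v ≤ 0 := not_le.mpr hv
    simp only [auxG, if_neg hv', sub_eq_add_neg, add_mul, Complex.exp_add]
    ring
  have j1 : IntegrableOn (fun v : ℝ => cexp (-(I * t) * v) * auxG y v) (Iic 0) :=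
    IntegrableOn.congr_fun ((i1.const_mul (-2)).add i2) e1.symm measurableSet_Iic
  have j2 : IntegrableOn (fun v : ℝ => cexp (-(I * t) * v) * auxG y v) (Ioi 0) :=
    IntegrableOn.congr_fun i3.neg e2.symm measurableSet_Ioi
  have hI : Integrable (fun v : ℝ => cexp (-(I * t) * v) * auxG y v) := by
    rw [← integrableOn_univ, ← Iic_union_Ioi (a := (0 : ℝ))]
    exact j1.union j2
  refine ⟨hI, ?_⟩
  rw [← integral_add_compl (s := Iic 0) measurableSet_Iic hI, compl_Iic,
    setIntegral_congr_fun measurableSet_Iic e1, setIntegral_congr_fun measurableSet_Ioi e2,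
    integral_add (i1.const_mul (-2)) i2, integral_const_mul, integral_neg,
    integral_exp_mul_complex_Iic r1, integral_exp_mul_complex_Iic r2,
    integral_exp_mul_complex_Ioi r3]
  simp [neg_div]

lemma den1 (y : ℝ) (hy : y < 0) (t : ℝ) : I * y - (t : ℂ) ≠ 0 := by
  intro h
  have := congrArg Complex.im h
  simp at this
  exact hy.ne this

lemma den2 (t : ℝ) : (t : ℂ) ^ 2 + 1 ≠ 0 := by
  have : (0 : ℝ) < t ^ 2 + 1 := by positivity
  exact_mod_cast this.ne'

lemma aux_alg (y : ℝ) (hy : y < 0) (t : ℝ) :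
    -2 * (1 / (-y - I * t)) + 1 / (1 - I * t) + 1 / (-1 - I * t) =
      2 * Real.pi * modCauchyKernel (I * y) t := by
  have h1 := den1 y hy t
  have h2 := den2 t
  have h3 : (-y - I * t : ℂ) = I * (I * y - t) := by
    linear_combination (-y : ℂ) * I_sq
  have h4 : (1 - I * t : ℂ) ≠ 0 := by
    intro h
    have := congrArg Complex.re h
    simp at this
  have h5 : (-1 - I * t : ℂ) ≠ 0 := by
    intro h
    have := congrArg Complex.re h
    simp at this
  have h6 : 1 / (1 - I * t) + 1 / (-1 - I * t) = 2 * I * (t / ((t : ℂ) ^ 2 + 1)) := by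
    field_simp
    linear_combination (-2 * I * t ^ 3 : ℂ) * I_sq
  have h7 : -2 * (1 / (-y - I * t)) = 2 * I * (1 / (I * y - t)) := by
    rw [h3]
    have := I_ne_zero
    field_simp
    linear_combination -I_sq
  have hpi : (Real.pi : ℂ) ≠ 0 := by exact_mod_cast Real.pi_ne_zero
  rw [add_assoc, h6, h7, modCauchyKernel]
  field_simp

lemma kernel_integrable (y : ℝ) (hy : y < 0) :
    Integrable (fun t : ℝ => modCauchyKernel (I * y) t) := by
  have hc : Continuous (fun t : ℝ => modCauchyKernel (I * y) t) := by
    unfold modCauchyKernel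
    refine continuous_const.mul ((continuous_const.div (by fun_prop) (den1 y hy)).add
      (Continuous.div (by fun_prop) (by fun_prop) den2))
  refine Integrable.mono' ((integrable_inv_one_add_sq).const_mul (1 / Real.pi * (1 / |y| + |y|)))
    hc.aestronglyMeasurable (Filter.Eventually.of_forall fun t => ?_)
  have h1 := den1 y hy t
  have h2 := den2 t
  have e : modCauchyKernel (I * y) t =
      (I / Real.pi) * ((1 + I * y * t) / (I * y - t)) * (((1 + t ^ 2 : ℝ) : ℂ)⁻¹) := by
    have h2' : (1 + (t : ℂ) ^ 2) ≠ 0 := by rwa [add_comm]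
    rw [modCauchyKernel, mul_assoc]
    congr 1
    push_cast
    rw [add_comm ((t : ℂ) ^ 2) 1]
    field_simp
    ring
  have hn : ‖(1 + I * y * t) / (I * y - t)‖ ≤ 1 / |y| + |y| := by
    have hy0 : 0 < |y| := abs_pos.mpr hy.ne
    rw [norm_div, div_le_iff₀ (norm_pos_iff.mpr h1)]
    refine (sq_le_sq₀ (by positivity) (by positivity)).mp ?_
    rw [mul_pow, ← normSq_eq_norm_sq, ← normSq_eq_norm_sq, normSq_apply, normSq_apply]
    simp
    have hyy : |y| ^ 2 = y ^ 2 := sq_abs y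
    have hi : |y|⁻¹ * |y| = 1 := inv_mul_cancel₀ hy0.ne'
    have : (|y|⁻¹ + |y|) ^ 2 * (t * t + y * y) = 1 + (y * t) * (y * t) + (|y|⁻¹ ^ 2 * t ^ 2
        + 2 * t ^ 2 + 2 * y ^ 2 + y ^ 2 * y ^ 2) := by
      have e1 : |y|⁻¹ ^ 2 * y ^ 2 = 1 := by rw [← hyy, ← mul_pow, hi, one_pow]
      linear_combination e1 + (t ^ 2 + y ^ 2) * hyy + 2 * (t ^ 2 + y ^ 2) * hi
    have h0 : 0 ≤ (|y|⁻¹ ^ 2 * t ^ 2 + 2 * t ^ 2 + 2 * y ^ 2 + y ^ 2 * y ^ 2) := by positivity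
    linarith
  rw [e, norm_mul, norm_mul, norm_inv, norm_real, Real.norm_of_nonneg (by positivity : 0 ≤ 1 + t ^ 2)]
  gcongr
  simp [abs_of_pos Real.pi_pos]

open FourierTransform in
lemma fourier_auxG (y : ℝ) (hy : y < 0) :
    𝓕 (auxG y) = fun w => 2 * Real.pi * modCauchyKernel (I * y) (2 * Real.pi * w) := by
  ext w
  have h := (aux_int y hy (2 * Real.pi * w)).2
  rw [aux_alg y hy] at h
  push_cast at h ⊢
  rw [Real.fourier_real_eq_integral_exp_smul, ← h]
  congr 1
  ext v
  rw [smul_eq_mul]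
  congr 2
  push_cast
  ring

open FourierTransform in
lemma main_aux (y : ℝ) (hy : y < 0) (x : ℝ) :
    ∫ t : ℝ, modCauchyKernel (I * y) t * cexp (I * x * t) = auxG y x := by
  have hF := fourier_auxG y hy
  have hI : Integrable (auxG y) := by simpa using (aux_int y hy 0).1
  have hFI : Integrable (𝓕 (auxG y)) := by
    rw [hF]
    exact ((kernel_integrable y hy).comp_mul_left' (R := 2 * Real.pi) (by positivity)).const_mul _
  have := congrFun ((auxG_continuous y).fourierInv_fourier_eq hI hFI) x
  rw [← this, Real.fourierInv_eq', hF]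
  have hs := Measure.integral_comp_mul_left
    (fun t : ℝ => modCauchyKernel (I * y) t * cexp (I * x * t)) (2 * Real.pi)
  have hs' : ∫ t : ℝ, modCauchyKernel (I * y) t * cexp (I * x * t) = (2 * Real.pi : ℂ) * 
      ∫ w : ℝ, modCauchyKernel (I * y) (2 * Real.pi * w) * cexp (I * x * (2 * Real.pi * w : ℝ)) := by
    rw [hs, abs_of_pos (by positivity), real_smul]
    have hpi : (Real.pi : ℂ) ≠ 0 := by exact_mod_cast Real.pi_ne_zero
    push_cast
    field_simp
  rw [hs', ← integral_const_mul]
  congr 1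
  ext v
  simp only [smul_eq_mul]
  have : cexp (I * x * (2 * Real.pi * v : ℝ)) = cexp (↑(2 * Real.pi * inner ℝ v x) * I) := by
    congr 1
    simp
    ring
  rw [this]
  ring

/-- For `y < 0`, the modified Cauchy kernel `t ↦ γ(iy; t)` is integrable on `ℝ`, its
Fourier transform at `x ≠ 0` equals `-2·𝟙_{(-∞,0]}(x) e^{-yx} - sign(x) e^{-|x|}`, and
at `x = 0` the integral equals `-1`. -/
theorem stmt_13 (y : ℝ) (hy : y < 0) :
    Integrable (fun t : ℝ => modCauchyKernel (Complex.I * y) t) ∧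
      (∀ x : ℝ, x ≠ 0 →
        ∫ t : ℝ, modCauchyKernel (Complex.I * y) t * Complex.exp (Complex.I * x * t) =
          ((-((Iic (0 : ℝ)).indicator (fun x : ℝ => 2 * Real.exp (-y * x)) x)
            - Real.sign x * Real.exp (-|x|) : ℝ) : ℂ)) ∧
      (∫ t : ℝ, modCauchyKernel (Complex.I * y) t * Complex.exp (Complex.I * (0 : ℝ) * t)) = -1 := by
  refine ⟨kernel_integrable y hy, fun x hx => ?_, ?_⟩
  · rw [main_aux y hy x, auxG]
    rcases lt_or_gt_of_ne hx with h | h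
    · rw [if_pos h.le, indicator_of_mem (show x ∈ Iic 0 from h.le), Real.sign_of_neg h,
        abs_of_neg h]
      push_cast
      ring_nf
    · rw [if_neg (not_le.mpr h), indicator_of_notMem (by simpa using h), Real.sign_of_pos h,
        abs_of_pos h]
      push_cast
      ring_nf
  · rw [main_aux y hy 0, auxG]
    simp
    norm_num
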